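/- There exists a 4-regular matchstick graph with exactly 78 vertices. -/

import Mathlib

open scoped Classical

/-- A matchstick graph: a finite set of points in the Euclidean plane together with
a finite set of unit-length non-crossing straight edges between distinct points. -/
structure MatchstickGraph where
  V : Finset (EuclideanSpace ℝ (Fin 2))
  E : Finset (Sym2 (EuclideanSpace ℝ (Fin 2)))
  edge_mem : ∀ e ∈ E, ∀ u v : EuclideanSpace ℝ (Fin 2), e = s(u, v) → u ∈ V ∧ v ∈ V
  edge_ne : ∀ e ∈ E, ¬ e.IsDiag
  edge_unit : ∀ e ∈ E, ∀ u v : EuclideanSpace ℝ (Fin 2), e = s(u, v) → dist u v = 1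
  noncross : ∀ e₁ ∈ E, ∀ e₂ ∈ E, e₁ ≠ e₂ →
    ∀ u v x y : EuclideanSpace ℝ (Fin 2), e₁ = s(u, v) → e₂ = s(x, y) →
      segment ℝ u v ∩ segment ℝ x y ⊆ (({u, v} : Set (EuclideanSpace ℝ (Fin 2))) ∩ {x, y})

/-- The degree of a vertex: the number of edges containing it. -/
noncomputable def MatchstickGraph.degree (G : MatchstickGraph)
    (v : EuclideanSpace ℝ (Fin 2)) : ℕ :=
  (G.E.filter (fun e => v ∈ e)).card

/-- A matchstick graph is 4-regular if every vertex has degree 4. -/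
def MatchstickGraph.IsFourRegular (G : MatchstickGraph) : Prop :=
  ∀ v ∈ G.V, G.degree v = 4

/-- A matchstick graph is (2,4)-regular if every vertex has degree 2 or degree 4. -/
def MatchstickGraph.IsTwoFourRegular (G : MatchstickGraph) : Prop :=
  ∀ v ∈ G.V, G.degree v = 2 ∨ G.degree v = 4

/-- Integer coordinates `(a, b, c, d)` of the point `((a + b √3) / 2, (c + d √3) / 2)`. -/
abbrev Coord : Type := ℤ × ℤ × ℤ × ℤ

namespace Coord

/-- The point of the plane with the given integer coordinates. -/
noncomputable def toPlane (p : Coord) : EuclideanSpace ℝ (Fin 2) :=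
  !₂[(p.1 + p.2.1 * √3) / 2, (p.2.2.1 + p.2.2.2 * √3) / 2]

/-- Reflection in the vertical axis. -/
def reflect (p : Coord) : Coord := (-p.1, -p.2.1, p.2.2.1, p.2.2.2)

/-- A criterion for the points `p` and `q` to be at unit distance. -/
def UnitDist (p q : Coord) : Prop :=
  (p.1 - q.1) ^ 2 + 3 * (p.2.1 - q.2.1) ^ 2
      + (p.2.2.1 - q.2.2.1) ^ 2 + 3 * (p.2.2.2 - q.2.2.2) ^ 2 = 4 ∧
    (p.1 - q.1) * (p.2.1 - q.2.1) + (p.2.2.1 - q.2.2.1) * (p.2.2.2 - q.2.2.2) = 0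

instance (p q : Coord) : Decidable (UnitDist p q) := by unfold UnitDist; infer_instance

/-- The pair `(m, n)` for which `m + n √3` is four times the inner product of `u` and `p`. -/
def dot (u p : Coord) : ℤ × ℤ :=
  (u.1 * p.1 + 3 * (u.2.1 * p.2.1) + (u.2.2.1 * p.2.2.1 + 3 * (u.2.2.2 * p.2.2.2)),
    u.1 * p.2.1 + u.2.1 * p.1 + (u.2.2.1 * p.2.2.2 + u.2.2.2 * p.2.2.1))

/-- A lower bound for `1000 * (x.1 + x.2 * √3)`. -/
def lowerBound (x : ℤ × ℤ) : ℤ := min (1000 * x.1 + 1732 * x.2) (1000 * x.1 + 1733 * x.2)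

/-- An upper bound for `1000 * (x.1 + x.2 * √3)`. -/
def upperBound (x : ℤ × ℤ) : ℤ := max (1000 * x.1 + 1732 * x.2) (1000 * x.1 + 1733 * x.2)

/-- A lower bound for the extent of the segment `e` in the direction of `u`. -/
def lowerExtent (u : Coord) (e : Coord × Coord) : ℤ :=
  min (lowerBound (dot u e.1)) (lowerBound (dot u e.2))

/-- An upper bound for the extent of the segment `e` in the direction of `u`. -/
def upperExtent (u : Coord) (e : Coord × Coord) : ℤ :=
  max (upperBound (dot u e.1)) (upperBound (dot u e.2))

/-- The twelve directions at multiples of thirty degrees. -/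
def directions : List Coord :=
  [(2, 0, 0, 0), (-2, 0, 0, 0), (0, 0, 2, 0), (0, 0, -2, 0),
   (0, 1, 1, 0), (0, -1, -1, 0), (1, 0, 0, 1), (-1, 0, 0, -1),
   (-1, 0, 0, 1), (1, 0, 0, -1), (0, -1, 1, 0), (0, 1, -1, 0)]

/-- Some direction strictly separates the segment `e` from the segment `f`. -/
def separated (e f : Coord × Coord) : Bool :=
  directions.any fun u => upperExtent u e < lowerExtent u f

/-- Two segments are compatible if they share exactly one endpoint or can be separated. -/
def Compatible (e f : Coord × Coord) : Prop :=
  separated e f = true ∨ (e.1 = f.1 ∧ e.2 ≠ f.2) ∨ (e.1 = f.2 ∧ e.2 ≠ f.1) ∨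
    (e.2 = f.1 ∧ e.1 ≠ f.2) ∨ (e.2 = f.2 ∧ e.1 ≠ f.1)

instance (e f : Coord × Coord) : Decidable (Compatible e f) := by
  unfold Compatible; infer_instance

lemma toPlane_injective : Function.Injective toPlane := by
  have key : ∀ a b c d : ℤ, ((a + b * √3) / 2 : ℝ) = (c + d * √3) / 2 → a = c ∧ b = d := by
    intro a b c d h
    have h' : ((b - d : ℤ) : ℝ) * √3 = ((c - a : ℤ) : ℝ) := by push_cast; linarith
    have hbd : b - d = 0 := by
      by_contra hne
      exact ((Nat.prime_three.irrational_sqrt).intCast_mul hne).ne_int (c - a) (by simpa using h')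
    rw [hbd] at h'
    have hca : c - a = 0 := by exact_mod_cast (by simpa using h'.symm : ((c - a : ℤ) : ℝ) = 0)
    omega
  rintro ⟨a, b, c, d⟩ ⟨a', b', c', d'⟩ h
  have h0 := congrArg (fun z : EuclideanSpace ℝ (Fin 2) => z 0) h
  have h1 := congrArg (fun z : EuclideanSpace ℝ (Fin 2) => z 1) h
  simp only [toPlane, PiLp.toLp_apply, Matrix.cons_val_zero, Matrix.cons_val_one] at h0 h1
  obtain ⟨rfl, rfl⟩ := key _ _ _ _ h0
  obtain ⟨rfl, rfl⟩ := key _ _ _ _ h1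
  rfl

lemma UnitDist.dist_eq_one {p q : Coord} (h : UnitDist p q) :
    dist (toPlane p) (toPlane q) = 1 := by
  obtain ⟨a, b, c, d⟩ := p
  obtain ⟨a', b', c', d'⟩ := q
  obtain ⟨h₁, h₂⟩ := h
  have h₁' : ((a : ℝ) - a') ^ 2 + 3 * (b - b') ^ 2 + (c - c') ^ 2 + 3 * (d - d') ^ 2 = 4 := by
    exact_mod_cast h₁
  have h₂' : ((a : ℝ) - a') * (b - b') + (c - c') * (d - d') = 0 := by exact_mod_cast h₂
  have hs : √3 ^ 2 = (3 : ℝ) := Real.sq_sqrt (by norm_num)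
  rw [EuclideanSpace.dist_eq, Real.sqrt_eq_one]
  simp only [toPlane, Fin.sum_univ_two, Real.dist_eq, sq_abs, PiLp.toLp_apply,
    Matrix.cons_val_zero, Matrix.cons_val_one]
  linear_combination h₁' / 4 + √3 / 2 * h₂' + ((b - b') ^ 2 + (d - d') ^ 2) / 4 * hs

lemma inner_toPlane (u p : Coord) :
    4 * inner ℝ u.toPlane p.toPlane = ((dot u p).1 + (dot u p).2 * √3 : ℝ) := by
  have hs : √3 ^ 2 = (3 : ℝ) := Real.sq_sqrt (by norm_num)
  simp only [toPlane, dot, PiLp.inner_apply, Fin.sum_univ_two, Matrix.cons_val_zero,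
    Matrix.cons_val_one, RCLike.inner_apply, conj_trivial]
  push_cast
  linear_combination ((u.2.1 : ℝ) * p.2.1 + u.2.2.2 * p.2.2.2) * hs

lemma lowerBound_le (x : ℤ × ℤ) : (lowerBound x : ℝ) ≤ 1000 * (x.1 + x.2 * √3) := by
  have lo : (1732 / 1000 : ℝ) ≤ √3 := Real.le_sqrt_of_sq_le (by norm_num)
  have hi : √3 ≤ (1733 / 1000 : ℝ) := Real.sqrt_le_iff.2 (by norm_num)
  rw [lowerBound, Int.cast_min, min_le_iff]
  push_cast
  rcases le_total (0 : ℝ) x.2 with h | h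
  · left; nlinarith [mul_le_mul_of_nonneg_left lo h]
  · right; nlinarith [mul_le_mul_of_nonpos_left hi h]

lemma le_upperBound (x : ℤ × ℤ) : 1000 * (x.1 + x.2 * √3) ≤ (upperBound x : ℝ) := by
  have lo : (1732 / 1000 : ℝ) ≤ √3 := Real.le_sqrt_of_sq_le (by norm_num)
  have hi : √3 ≤ (1733 / 1000 : ℝ) := Real.sqrt_le_iff.2 (by norm_num)
  rw [upperBound, Int.cast_max, le_max_iff]
  push_cast
  rcases le_total (0 : ℝ) x.2 with h | h
  · right; nlinarith [mul_le_mul_of_nonneg_left hi h]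
  · left; nlinarith [mul_le_mul_of_nonpos_left lo h]

lemma inner_lt_inner_of_bound_lt {u p q : Coord}
    (h : upperBound (dot u p) < lowerBound (dot u q)) :
    inner ℝ u.toPlane p.toPlane < inner ℝ u.toPlane q.toPlane := by
  have h₁ := le_upperBound (dot u p)
  have h₂ := lowerBound_le (dot u q)
  have h₃ : (upperBound (dot u p) : ℝ) < lowerBound (dot u q) := by exact_mod_cast h
  rw [← inner_toPlane] at h₁ h₂
  linarith

end Coord

open Coord

section Segments

variable {F : Type*} [NormedAddCommGroup F] [InnerProductSpace ℝ F]

lemma disjoint_segment_of_inner_lt {n u v x y : F}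
    (h₁ : inner ℝ n u < inner ℝ n x) (h₂ : inner ℝ n u < inner ℝ n y)
    (h₃ : inner ℝ n v < inner ℝ n x) (h₄ : inner ℝ n v < inner ℝ n y) :
    Disjoint (segment ℝ u v) (segment ℝ x y) := by
  rw [Set.disjoint_left]
  rintro z ⟨a, b, ha, hb, hab, rfl⟩ ⟨c, d, hc, hd, hcd, hz⟩
  have h := congrArg (inner ℝ n) hz
  simp only [inner_add_right, inner_smul_right] at h
  have hle : a * inner ℝ n u + b * inner ℝ n v ≤ max (inner ℝ n u) (inner ℝ n v) := by
    calc _ ≤ a * max (inner ℝ n u) (inner ℝ n v) + b * max (inner ℝ n u) (inner ℝ n v) := by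
          gcongr <;> simp
      _ = _ := by rw [← add_mul, hab, one_mul]
  have hge : min (inner ℝ n x) (inner ℝ n y) ≤ c * inner ℝ n x + d * inner ℝ n y := by
    calc _ = c * min (inner ℝ n x) (inner ℝ n y) + d * min (inner ℝ n x) (inner ℝ n y) := by
          rw [← add_mul, hcd, one_mul]
      _ ≤ _ := by gcongr <;> simp
  have hlt : max (inner ℝ n u) (inner ℝ n v) < min (inner ℝ n x) (inner ℝ n y) := by
    simp only [max_lt_iff, lt_min_iff]; tauto
  linarith

lemma segment_inter_segment_subset_of_dist_eq {u v w : F} {r : ℝ} (hr : 0 < r)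
    (hv : dist u v = r) (hw : dist u w = r) (hvw : v ≠ w) :
    segment ℝ u v ∩ segment ℝ u w ⊆ {u} := by
  rw [segment_eq_image', segment_eq_image']
  rintro z ⟨⟨s, ⟨hs, -⟩, rfl⟩, t, ⟨ht, -⟩, hz⟩
  have hz : t • (w - u) = s • (v - u) := add_left_cancel hz
  have hts : t = s := by
    have := congrArg norm hz
    rw [norm_smul, norm_smul, ← dist_eq_norm, ← dist_eq_norm, dist_comm w, dist_comm v, hv, hw,
      Real.norm_of_nonneg hs, Real.norm_of_nonneg ht] at this
    exact mul_right_cancel₀ hr.ne' this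
  subst hts
  have hs0 : t = 0 := by
    by_contra hne
    exact hvw (sub_left_injective (smul_right_injective F hne hz)).symm
  simp [hs0]

end Segments

/-- The edges `e` and `f`, viewed as segments, intersect only in common endpoints. -/
def MeetInEndpoints (e f : Coord × Coord) : Prop :=
  segment ℝ e.1.toPlane e.2.toPlane ∩ segment ℝ f.1.toPlane f.2.toPlane ⊆
    (({e.1.toPlane, e.2.toPlane} : Set (EuclideanSpace ℝ (Fin 2))) ∩
      {f.1.toPlane, f.2.toPlane})

lemma MeetInEndpoints.symm {e f : Coord × Coord} (h : MeetInEndpoints e f) :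
    MeetInEndpoints f e := by
  unfold MeetInEndpoints
  rw [Set.inter_comm, Set.inter_comm {_, _}]
  exact h

lemma meetInEndpoints_of_common_vertex {u v w : Coord} (hv : UnitDist u v) (hw : UnitDist u w)
    (hvw : v ≠ w) : MeetInEndpoints (u, v) (u, w) := fun z hz => by
  have := segment_inter_segment_subset_of_dist_eq one_pos hv.dist_eq_one hw.dist_eq_one
    (toPlane_injective.ne hvw) hz
  simp_all

lemma meetInEndpoints_swap_left (e f : Coord × Coord) :
    MeetInEndpoints e.swap f ↔ MeetInEndpoints e f := by
  simp only [MeetInEndpoints, Prod.fst_swap, Prod.snd_swap, segment_symm ℝ e.2.toPlane,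
    Set.pair_comm e.2.toPlane]

lemma meetInEndpoints_swap_right (e f : Coord × Coord) :
    MeetInEndpoints e f.swap ↔ MeetInEndpoints e f := by
  simp only [MeetInEndpoints, Prod.fst_swap, Prod.snd_swap, segment_symm ℝ f.2.toPlane,
    Set.pair_comm f.2.toPlane]

lemma Coord.UnitDist.symm {p q : Coord} (h : UnitDist p q) : UnitDist q p := by
  obtain ⟨h₁, h₂⟩ := h
  exact ⟨by linear_combination h₁, by linear_combination h₂⟩

lemma Coord.Compatible.meetInEndpoints {e f : Coord × Coord} (h : Compatible e f)
    (he : UnitDist e.1 e.2) (hf : UnitDist f.1 f.2) : MeetInEndpoints e f := by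
  obtain ⟨p, q⟩ := e
  obtain ⟨r, s⟩ := f
  rcases h with h | ⟨h, hne⟩ | ⟨h, hne⟩ | ⟨h, hne⟩ | ⟨h, hne⟩
  · simp only [separated, List.any_eq_true, decide_eq_true_eq, upperExtent, lowerExtent,
      max_lt_iff, lt_min_iff] at h
    obtain ⟨u, -, ⟨h₁, h₂⟩, h₃, h₄⟩ := h
    have := disjoint_segment_of_inner_lt (inner_lt_inner_of_bound_lt h₁)
      (inner_lt_inner_of_bound_lt h₃) (inner_lt_inner_of_bound_lt h₂) (inner_lt_inner_of_bound_lt h₄)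
    rw [MeetInEndpoints, this.inter_eq]
    exact Set.empty_subset _
  all_goals dsimp only at h hne he hf; subst h
  · exact meetInEndpoints_of_common_vertex he hf hne
  · exact (meetInEndpoints_swap_right _ _).1 (meetInEndpoints_of_common_vertex he hf.symm hne)
  · exact (meetInEndpoints_swap_left _ _).1 (meetInEndpoints_of_common_vertex he.symm hf hne)
  · exact (meetInEndpoints_swap_left _ _).1 ((meetInEndpoints_swap_right _ _).1
      (meetInEndpoints_of_common_vertex he.symm hf.symm hne))

/-- Representatives of the orbits of edges of length four under the two axis reflections. -/
def genericEdges : List (Coord × Coord) :=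
  [((4, 2, 1, 0), (4, 2, 3, 0)), ((3, 2, 3, 1), (4, 2, 3, 0)), ((4, 1, 2, 0), (4, 2, 3, 0)),
   ((4, 1, 2, 0), (4, 2, 1, 0)), ((4, 1, 0, 0), (4, 2, 1, 0)), ((2, 2, 3, 0), (4, 2, 3, 0)),
   ((2, 2, 3, 2), (3, 2, 3, 1)), ((2, 2, 3, 0), (3, 2, 3, 1)), ((4, 1, 0, 0), (4, 1, 2, 0)),
   ((1, 2, 3, 1), (3, 2, 3, 1)), ((1, 2, 3, 1), (2, 2, 3, 2)), ((1, 2, 3, 1), (2, 2, 3, 0)),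
   ((2, 1, 2, 0), (4, 1, 2, 0)), ((2, 1, 4, 2), (2, 2, 3, 2)), ((2, 1, 2, 2), (2, 2, 3, 2)),
   ((2, 1, 2, 0), (2, 2, 3, 0)), ((2, 1, 2, 2), (2, 1, 4, 2)), ((2, 1, 0, 0), (2, 1, 2, 0)),
   ((1, 1, 2, 1), (1, 2, 3, 1)), ((1, 1, 2, 1), (2, 1, 2, 2)), ((1, 1, 2, 1), (2, 1, 2, 0)),
   ((1, 1, 0, 1), (2, 1, 0, 0)), ((2, 0, 5, 2), (2, 1, 4, 2)), ((2, 0, 3, 2), (2, 1, 4, 2)),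
   ((2, 0, 3, 2), (2, 1, 2, 2)), ((1, 1, 0, 1), (1, 1, 2, 1)), ((0, 1, 0, 0), (1, 1, 0, 1)),
   ((2, 0, 3, 2), (2, 0, 5, 2)), ((1, 0, 1, 1), (1, 1, 0, 1)), ((1, 0, 5, 1), (2, 0, 5, 2)),
   ((1, 0, 3, 1), (2, 0, 3, 2)), ((0, 0, 5, 2), (2, 0, 5, 2)), ((1, 0, 3, 1), (1, 0, 5, 1)),
   ((1, 0, 1, 1), (1, 0, 3, 1)), ((0, 0, 1, 0), (0, 1, 0, 0)), ((0, 0, 5, 2), (1, 0, 5, 1)),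
   ((0, 0, 1, 0), (1, 0, 1, 1))]

/-- Representatives of the orbits of edges of length two under the two axis reflections. -/
def crossingEdges : List (Coord × Coord) :=
  [((4, 2, -1, 0), (4, 2, 1, 0)), ((-1, 0, 5, 1), (1, 0, 5, 1)), ((-1, 0, 3, 1), (1, 0, 3, 1)),
   ((-1, 0, 1, 1), (1, 0, 1, 1))]

/-- Representatives of the edges under the half-turn about the origin. -/
def halfEdges : List (Coord × Coord) :=
  genericEdges ++ genericEdges.map (Prod.map reflect reflect) ++ crossingEdges

/-- The edges of a 4-regular matchstick graph on 78 vertices. -/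
def edges78 : List (Coord × Coord) :=
  halfEdges ++ halfEdges.map (Prod.map Neg.neg Neg.neg)

/-- The vertices of a 4-regular matchstick graph on 78 vertices. -/
def vertices78 : List Coord :=
  (edges78.map Prod.fst ++ edges78.map Prod.snd).dedup

lemma fst_mem_vertices78 {e : Coord × Coord} (he : e ∈ edges78) : e.1 ∈ vertices78 :=
  List.mem_dedup.2 (List.mem_append_left _ (List.mem_map_of_mem he))

lemma snd_mem_vertices78 {e : Coord × Coord} (he : e ∈ edges78) : e.2 ∈ vertices78 :=
  List.mem_dedup.2 (List.mem_append_right _ (List.mem_map_of_mem he))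

lemma unitDist_edges78 : ∀ e ∈ edges78, UnitDist e.1 e.2 := by decide +kernel

lemma pairwise_compatible_edges78 : edges78.Pairwise Compatible := by decide +kernel

lemma nodup_vertices78 : vertices78.Nodup := List.nodup_dedup _

lemma length_vertices78 : vertices78.length = 78 := by decide +kernel

lemma nodup_edges78 : (edges78.map fun e => s(e.1, e.2)).Nodup := by decide +kernel

lemma degree_edges78 : ∀ v ∈ vertices78,
    ((edges78.map fun e => s(e.1, e.2)).filter (v ∈ ·)).length = 4 := by decide +kernel

attribute [irreducible] edges78 vertices78

lemma meetInEndpoints_edges78 {e f : Coord × Coord} (he : e ∈ edges78) (hf : f ∈ edges78)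
    (hne : e ≠ f) : MeetInEndpoints e f := by
  have : Std.Symm MeetInEndpoints := ⟨fun _ _ => MeetInEndpoints.symm⟩
  refine List.Pairwise.forall (pairwise_compatible_edges78.imp_of_mem fun ha hb hab => ?_) he hf hne
  exact hab.meetInEndpoints (unitDist_edges78 _ ha) (unitDist_edges78 _ hb)

/-- The embedding of pairs of integer coordinates into pairs of points of the plane. -/
noncomputable def edgeEmbedding : Sym2 Coord ↪ Sym2 (EuclideanSpace ℝ (Fin 2)) :=
  ⟨Sym2.map toPlane, Sym2.map.injective toPlane_injective⟩

/-- The edges of `edges78` as pairs of points of the plane. -/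
noncomputable def edgeSet78 : Finset (Sym2 (EuclideanSpace ℝ (Fin 2))) :=
  (edges78.map fun e => s(e.1, e.2)).toFinset.map edgeEmbedding

lemma mem_edgeSet78 {e : Sym2 (EuclideanSpace ℝ (Fin 2))} :
    e ∈ edgeSet78 ↔ ∃ f ∈ edges78, s(f.1.toPlane, f.2.toPlane) = e := by
  simp [edgeSet78, edgeEmbedding]

/-- A 4-regular matchstick graph on 78 vertices. -/
noncomputable def matchstick78 : MatchstickGraph where
  V := vertices78.toFinset.map ⟨toPlane, toPlane_injective⟩
  E := edgeSet78
  edge_mem := by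
    rintro e he u v rfl
    simp only [mem_edgeSet78, Sym2.eq_iff] at he
    obtain ⟨e, he, ⟨rfl, rfl⟩ | ⟨rfl, rfl⟩⟩ := he <;>
      simp [fst_mem_vertices78 he, snd_mem_vertices78 he]
  edge_ne := by
    intro e he h
    obtain ⟨p, hp, rfl⟩ := mem_edgeSet78.1 he
    have := (unitDist_edges78 p hp).dist_eq_one
    simp [Sym2.mk_isDiag_iff.1 h] at this
  edge_unit := by
    rintro e he u v rfl
    simp only [mem_edgeSet78, Sym2.eq_iff] at he
    obtain ⟨e, he, ⟨rfl, rfl⟩ | ⟨rfl, rfl⟩⟩ := he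
    · exact (unitDist_edges78 e he).dist_eq_one
    · exact (unitDist_edges78 e he).symm.dist_eq_one
  noncross := by
    rintro _ he _ hf hne u v x y rfl rfl
    obtain ⟨e, he', h⟩ := mem_edgeSet78.1 he
    obtain ⟨f, hf', h'⟩ := mem_edgeSet78.1 hf
    have hef : e ≠ f := by
      rintro rfl
      exact hne (h.symm.trans h')
    have := meetInEndpoints_edges78 he' hf' hef
    rcases Sym2.eq_iff.1 h with ⟨rfl, rfl⟩ | ⟨rfl, rfl⟩ <;>
      rcases Sym2.eq_iff.1 h' with ⟨rfl, rfl⟩ | ⟨rfl, rfl⟩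
    · exact this
    · exact (meetInEndpoints_swap_right e f).2 this
    · exact (meetInEndpoints_swap_left e f).2 this
    · exact (meetInEndpoints_swap_left e f.swap).2 ((meetInEndpoints_swap_right e f).2 this)

lemma degree_matchstick78 {v : Coord} (hv : v ∈ vertices78) :
    matchstick78.degree v.toPlane = 4 := by
  rw [← degree_edges78 v hv, ← List.toFinset_card_of_nodup (nodup_edges78.filter _),
    ← Finset.card_map edgeEmbedding, MatchstickGraph.degree]
  congr 1
  ext e
  simp only [matchstick78, edgeSet78, Finset.mem_filter, Finset.mem_map, List.mem_toFinset,
    List.mem_filter, decide_eq_true_eq]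
  constructor
  · rintro ⟨⟨e, he, rfl⟩, hve⟩
    obtain ⟨w, hw, hwv⟩ := Sym2.mem_map.1 hve
    exact ⟨e, ⟨he, toPlane_injective hwv ▸ hw⟩, rfl⟩
  · rintro ⟨e, ⟨he, hve⟩, rfl⟩
    exact ⟨⟨e, he, rfl⟩, Sym2.mem_map.2 ⟨v, hve, rfl⟩⟩

/-- There exists a 4-regular matchstick graph with exactly 78 vertices. -/
theorem exists_fourRegular_matchstick_78 :
    ∃ G : MatchstickGraph, G.IsFourRegular ∧ G.V.card = 78 := by
  refine ⟨matchstick78, fun v hv => ?_, ?_⟩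
  · obtain ⟨w, hw, rfl⟩ := Finset.mem_map.1 hv
    exact degree_matchstick78 (List.mem_toFinset.1 hw)
  · rw [matchstick78, Finset.card_map, List.toFinset_card_of_nodup nodup_vertices78,
      length_vertices78]
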